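/- Let n ≥ 1 and r = n+1. Then the kernel of the linear map Θ′_n is one-dimensional. -/

import Mathlib

open scoped BigOperators

/-- A perfect matching of `{0,…,N-1}`, encoded as a fixed-point-free involution:
the two-element blocks of the matching are the orbits `{i, σ i}`. -/
abbrev PM (N : ℕ) := {σ : Equiv.Perm (Fin N) // (∀ i, σ (σ i) = i) ∧ ∀ i, σ i ≠ i}

/-- The standard symplectic form `ω(u,v) = Σ_{a=1}^n (u_a v_{n+a} - u_{n+a} v_a)` on `ℂ^{2n}`. -/
noncomputable def sympC (n : ℕ) (u w : Fin (2*n) → ℂ) : ℂ :=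
  ∑ a : Fin n,
    (u ⟨a.val, by have := a.isLt; omega⟩ * w ⟨n + a.val, by have := a.isLt; omega⟩
     - u ⟨n + a.val, by have := a.isLt; omega⟩ * w ⟨a.val, by have := a.isLt; omega⟩)

/-- The `2r`-multilinear form `φ_M(v) = ∏_{{i,j}∈M, i<j} ω(v_i, v_j)` on `ℂ^{2n}`
attached to a perfect matching `M`. -/
noncomputable def phiS (n r : ℕ) (M : PM (2*r)) : (Fin (2*r) → Fin (2*n) → ℂ) → ℂ :=
  fun v => ∏ i ∈ Finset.univ.filter (fun i : Fin (2*r) => i < M.1 i), sympC n (v i) (v (M.1 i))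

/-- The linear map `Θ'_n : ℂ[M(2r)] → (2r-multilinear forms on ℂ^{2n})`, `M ↦ φ_M`. -/
noncomputable def ThetaS (n r : ℕ) :
    (PM (2*r) →₀ ℂ) →ₗ[ℂ] ((Fin (2*r) → Fin (2*n) → ℂ) → ℂ) :=
  Finsupp.linearCombination ℂ (phiS n r)

namespace PM

/-- The involution of `Fin r × Bool` exchanging the two elements `(k, false)`, `(k, true)` of each
block. -/
def flip (r : ℕ) : Equiv.Perm (Fin r × Bool) :=
  Equiv.prodCongrRight fun _ => Equiv.boolNot

@[simp] lemma flip_apply {r : ℕ} (p : Fin r × Bool) : flip r p = (p.1, !p.2) := rfl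

/-- The perfect matching whose blocks are `{g (k, false), g (k, true)}`. -/
def ofEquiv {r N : ℕ} (g : Fin r × Bool ≃ Fin N) : PM N :=
  ⟨g.symm.trans ((flip r).trans g), by intro i; simp, by
    intro i h
    have h2 := congrArg g.symm h
    simp only [Equiv.trans_apply, Equiv.symm_apply_apply, flip_apply] at h2
    have h3 := congrArg Prod.snd h2
    simp at h3⟩

@[simp] lemma ofEquiv_apply {r N : ℕ} (g : Fin r × Bool ≃ Fin N) (p : Fin r × Bool) :
    (ofEquiv g).1 (g p) = g (p.1, !p.2) := by
  simp [ofEquiv]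

lemma ext_of_equiv {r N : ℕ} (g : Fin r × Bool ≃ Fin N) {M M' : PM N}
    (h : ∀ p, M.1 (g p) = M'.1 (g p)) : M = M' := by
  apply Subtype.ext
  apply Equiv.ext
  intro i
  simpa using h (g.symm i)

lemma cycleType_eq {r : ℕ} (M : PM (2 * r)) : M.1.cycleType = Multiset.replicate r 2 := by
  have hsq : M.1 ^ 2 = 1 := by
    ext i; simp [pow_two, M.2.1 i]
  have h2 : ∀ k ∈ M.1.cycleType, k = 2 := by
    intro k hk
    have h1 := Equiv.Perm.two_le_of_mem_cycleType hk
    have h3 := (Equiv.Perm.dvd_of_mem_cycleType hk).trans (orderOf_dvd_of_pow_eq_one hsq)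
    exact le_antisymm (Nat.le_of_dvd (by norm_num) h3) h1
  have h3 := Multiset.eq_replicate_card.2 h2
  have hs : M.1.support = Finset.univ := by
    ext i; simp [M.2.2 i]
  have h4 := Equiv.Perm.sum_cycleType M.1
  rw [hs, h3] at h4
  simp at h4
  rw [h3]
  congr 1
  omega

lemma exists_ofEquiv_eq {r : ℕ} (e : Fin r × Bool ≃ Fin (2 * r)) (M : PM (2 * r)) :
    ∃ σ : Equiv.Perm (Fin r × Bool), M = ofEquiv (σ.trans e) := by
  have h : IsConj (ofEquiv e).1 M.1 := by
    rw [Equiv.Perm.isConj_iff_cycleType_eq, cycleType_eq, cycleType_eq]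
  obtain ⟨τ, hτ⟩ := isConj_iff.1 h
  refine ⟨(e.trans τ).trans e.symm, Subtype.ext ?_⟩
  rw [← hτ]
  ext i
  simp [ofEquiv]

lemma exists_ordered_equiv (r : ℕ) :
    ∃ e : Fin r × Bool ≃ Fin (2 * r), ∀ k, e (k, false) < e (k, true) := by
  refine ⟨((Equiv.prodCongrRight fun _ => finTwoEquiv.symm).trans finProdFinEquiv).trans
    (finCongr (mul_comm r 2)), fun k => ?_⟩
  simp [Fin.lt_def, finProdFinEquiv, finTwoEquiv]

/-- The sign comparing the order of each block `(g (k, false), g (k, true))` with the order of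
`Fin N`. -/
def orderSign {r N : ℕ} (g : Fin r × Bool ≃ Fin N) : ℤˣ :=
  ∏ k, if g (k, false) < g (k, true) then 1 else -1

lemma sign_mul_orderSign {r N : ℕ} {e : Fin r × Bool ≃ Fin N}
    (he : ∀ k, e (k, false) < e (k, true)) {σ : Equiv.Perm (Fin r × Bool)}
    (hσ : ofEquiv (σ.trans e) = ofEquiv e) :
    Equiv.Perm.sign σ * orderSign (σ.trans e) = 1 := by
  have hcomm : ∀ p : Fin r × Bool, σ (p.1, !p.2) = ((σ p).1, !(σ p).2) := by
    intro p
    have h := ofEquiv_apply (σ.trans e) p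
    rw [hσ, Equiv.trans_apply, ofEquiv_apply, Equiv.trans_apply] at h
    exact (e.injective h).symm
  have htrue : ∀ k, σ (k, true) = ((σ (k, false)).1, !(σ (k, false)).2) := fun k =>
    hcomm (k, false)
  have hinj : Function.Injective fun k => (σ (k, false)).1 := by
    intro k l hkl
    simp only at hkl
    by_cases hb : (σ (k, false)).2 = (σ (l, false)).2
    · have := σ.injective (Prod.ext hkl hb)
      simpa using this
    · have : σ (k, false) = σ (l, true) := by
        rw [htrue]
        refine Prod.ext hkl ?_
        revert hb
        cases (σ (k, false)).2 <;> cases (σ (l, false)).2 <;> simp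
      simpa using σ.injective this
  let τ : Equiv.Perm (Fin r) := Equiv.ofBijective _ (Finite.injective_iff_bijective.1 hinj)
  let b : Fin r → Equiv.Perm Bool := fun k =>
    if (σ (k, false)).2 = false then 1 else Equiv.swap false true
  have hdecomp : σ = Equiv.prodCongrLeft (fun _ : Bool => τ) * Equiv.prodCongrRight b := by
    apply Equiv.ext
    rintro ⟨k, s⟩
    simp only [Equiv.Perm.mul_apply, Equiv.prodCongrRight_apply, Equiv.prodCongrLeft_apply]
    cases s
    · refine Prod.ext rfl ?_
      cases hs : (σ (k, false)).2 <;> simp [b, hs]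
    · rw [htrue]
      refine Prod.ext rfl ?_
      cases hs : (σ (k, false)).2 <;> simp [b, hs]
  have hsign : Equiv.Perm.sign σ = ∏ k, Equiv.Perm.sign (b k) := by
    conv_lhs => rw [hdecomp]
    rw [Equiv.Perm.sign_mul, Equiv.Perm.sign_prodCongrRight, Equiv.Perm.sign_prodCongrLeft]
    simp
  rw [hsign, orderSign, ← Finset.prod_mul_distrib]
  refine Finset.prod_eq_one fun k _ => ?_
  simp only [Equiv.trans_apply, htrue]
  rcases hs : σ (k, false) with ⟨l, s⟩
  cases s
  · simp [b, hs, he]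
  · simp [b, hs, (he l).le]

end PM

lemma sympC_swap (n : ℕ) (u w : Fin (2 * n) → ℂ) : sympC n u w = -sympC n w u := by
  simp only [sympC, ← Finset.sum_neg_distrib]
  exact Finset.sum_congr rfl fun a _ => by ring

lemma sympC_add_left (n : ℕ) (u u' w : Fin (2 * n) → ℂ) :
    sympC n (u + u') w = sympC n u w + sympC n u' w := by
  simp only [sympC, ← Finset.sum_add_distrib, Pi.add_apply]
  exact Finset.sum_congr rfl fun a _ => by ring

lemma sympC_smul_left (n : ℕ) (c : ℂ) (u w : Fin (2 * n) → ℂ) :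
    sympC n (c • u) w = c * sympC n u w := by
  simp only [sympC, Finset.mul_sum, Pi.smul_apply, smul_eq_mul]
  exact Finset.sum_congr rfl fun a _ => by ring

lemma sympC_add_right (n : ℕ) (u w w' : Fin (2 * n) → ℂ) :
    sympC n u (w + w') = sympC n u w + sympC n u w' := by
  rw [sympC_swap, sympC_add_left, sympC_swap n w, sympC_swap n w']; ring

lemma sympC_smul_right (n : ℕ) (c : ℂ) (u w : Fin (2 * n) → ℂ) :
    sympC n u (c • w) = c * sympC n u w := by
  rw [sympC_swap, sympC_smul_left, sympC_swap n w]; ring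

/-- The symplectic basis of `ℂ^{2n}`: `(a, false)` and `(a, true)` index dual vectors. -/
noncomputable def sympBasis (n : ℕ) (p : Fin n × Bool) : Fin (2 * n) → ℂ :=
  Pi.single (if p.2 then ⟨n + p.1.val, by have := p.1.isLt; omega⟩
    else ⟨p.1.val, by have := p.1.isLt; omega⟩) 1

lemma sympC_sympBasis_ne_zero_iff {n : ℕ} (p q : Fin n × Bool) :
    sympC n (sympBasis n p) (sympBasis n q) ≠ 0 ↔ q = (p.1, !p.2) := by
  obtain ⟨a, s⟩ := p
  obtain ⟨b, t⟩ := q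
  have h1 : ∀ x y : Fin n, x.val ≠ n + y.val := fun x y => by omega
  have h2 : ∀ x y : Fin n, n + x.val ≠ y.val := fun x y => by omega
  cases s <;> cases t <;>
    simp [sympC, sympBasis, Pi.single_apply, h1, h2, ← Fin.ext_iff, eq_comm]

lemma phiS_ofEquiv {n r : ℕ} (g : Fin r × Bool ≃ Fin (2 * r))
    (v : Fin (2 * r) → Fin (2 * n) → ℂ) :
    phiS n r (PM.ofEquiv g) v =
      ((PM.orderSign g : ℤ) : ℂ) * ∏ k, sympC n (v (g (k, false))) (v (g (k, true))) := by
  rw [phiS, Finset.prod_filter, ← Equiv.prod_comp g, Fintype.prod_prod_type, PM.orderSign,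
    Units.coe_prod, Int.cast_prod, ← Finset.prod_mul_distrib]
  refine Finset.prod_congr rfl fun k _ => ?_
  have hne : g (k, false) ≠ g (k, true) := by simp
  rw [Fintype.prod_bool]
  simp only [PM.ofEquiv_apply, Bool.not_true, Bool.not_false]
  rcases hne.lt_or_gt with h | h
  · simp [h, h.not_gt]
  · simp [h, h.not_gt, sympC_swap n (v (g (k, true)))]

lemma phiS_sympBasis_ne_zero_iff {n r : ℕ} (M : PM (2 * r)) (L : Fin (2 * r) → Fin n × Bool) :
    phiS n r M (fun i => sympBasis n (L i)) ≠ 0 ↔ ∀ i, L (M.1 i) = ((L i).1, !(L i).2) := by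
  simp only [phiS, Finset.prod_ne_zero_iff, Finset.mem_filter, Finset.mem_univ, true_and,
    sympC_sympBasis_ne_zero_iff]
  refine ⟨fun h i => ?_, fun h i _ => h i⟩
  rcases (M.2.2 i).lt_or_gt with hi | hi
  · have := h (M.1 i) (by rwa [M.2.1 i])
    rw [M.2.1 i] at this
    simp [this]
  · exact h i hi

/-- The multilinear form `w ↦ ∏_k ω(w (k, false), w (k, true))`. -/
noncomputable def sympProd (n r : ℕ) :
    MultilinearMap ℂ (fun _ : Fin r × Bool => Fin (2 * n) → ℂ) ℂ where
  toFun w := ∏ k, sympC n (w (k, false)) (w (k, true))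
  map_update_add' := by
    intro inst w p x y
    obtain rfl : inst = instDecidableEqProd := Subsingleton.elim _ _
    obtain ⟨j, s⟩ := p
    simp only [← Finset.mul_prod_erase _ _ (Finset.mem_univ j)]
    have h : ∀ z : Fin (2 * n) → ℂ, ∏ k ∈ Finset.univ.erase j,
        sympC n (Function.update w (j, s) z (k, false)) (Function.update w (j, s) z (k, true)) =
        ∏ k ∈ Finset.univ.erase j, sympC n (w (k, false)) (w (k, true)) := fun z =>
      Finset.prod_congr rfl fun k hk => by
        simp [(Finset.mem_erase.1 hk).1]
    simp only [h]
    cases s <;> simp [sympC_add_left, sympC_add_right, add_mul]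
  map_update_smul' := by
    intro inst w p c x
    obtain rfl : inst = instDecidableEqProd := Subsingleton.elim _ _
    obtain ⟨j, s⟩ := p
    simp only [← Finset.mul_prod_erase _ _ (Finset.mem_univ j)]
    have h : ∀ z : Fin (2 * n) → ℂ, ∏ k ∈ Finset.univ.erase j,
        sympC n (Function.update w (j, s) z (k, false)) (Function.update w (j, s) z (k, true)) =
        ∏ k ∈ Finset.univ.erase j, sympC n (w (k, false)) (w (k, true)) := fun z =>
      Finset.prod_congr rfl fun k hk => by
        simp [(Finset.mem_erase.1 hk).1]
    simp only [h]
    cases s <;> simp [sympC_smul_left, sympC_smul_right, mul_assoc]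

/-- The Pfaffian element of `ℂ[M(2r)]`, up to a positive factor. -/
noncomputable def pfaffianElt {r : ℕ} (e : Fin r × Bool ≃ Fin (2 * r)) : PM (2 * r) →₀ ℂ :=
  ∑ σ : Equiv.Perm (Fin r × Bool),
    Finsupp.single (PM.ofEquiv (σ.trans e))
      (((Equiv.Perm.sign σ * PM.orderSign (σ.trans e) : ℤˣ) : ℤ) : ℂ)

lemma pfaffianElt_apply_ne_zero {r : ℕ} {e : Fin r × Bool ≃ Fin (2 * r)}
    (he : ∀ k, e (k, false) < e (k, true)) : pfaffianElt e (PM.ofEquiv e) ≠ 0 := by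
  have h : pfaffianElt e (PM.ofEquiv e) = ∑ σ : Equiv.Perm (Fin r × Bool),
      if PM.ofEquiv (σ.trans e) = PM.ofEquiv e then (1 : ℂ) else 0 := by
    rw [pfaffianElt, Finsupp.finsetSum_apply]
    refine Finset.sum_congr rfl fun σ _ => ?_
    rw [Finsupp.single_apply]
    split_ifs with hσ
    · rw [PM.sign_mul_orderSign he hσ]; simp
    · rfl
  rw [h, Finset.sum_boole, Nat.cast_ne_zero, Finset.card_ne_zero]
  exact ⟨Equiv.refl _, by simp⟩

lemma ThetaS_pfaffianElt {n r : ℕ} (h : n < r) (e : Fin r × Bool ≃ Fin (2 * r)) :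
    ThetaS n r (pfaffianElt e) = 0 := by
  funext v
  have halt : MultilinearMap.alternatization (sympProd n r) (fun p => v (e p)) = 0 := by
    apply AlternatingMap.map_linearDependent
    intro hli
    have := hli.fintype_card_le_finrank
    simp at this
    omega
  rw [MultilinearMap.alternatization_apply] at halt
  rw [pfaffianElt, map_sum, Finset.sum_apply, Pi.zero_apply, ← halt]
  refine Finset.sum_congr rfl fun σ _ => ?_
  have hsq : ((PM.orderSign (σ.trans e) : ℤ) : ℂ) * ((PM.orderSign (σ.trans e) : ℤ) : ℂ) = 1 := by
    rw [← Int.cast_mul, ← Units.val_mul, Int.units_mul_self]; simp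
  rw [ThetaS, Finsupp.linearCombination_single, Pi.smul_apply, phiS_ofEquiv, smul_eq_mul,
    Units.val_mul, Int.cast_mul, Units.smul_def, zsmul_eq_mul, mul_assoc,
    ← mul_assoc (((PM.orderSign _ : ℤˣ) : ℤ) : ℂ), hsq, one_mul]
  rfl

lemma exists_fin_collapse {n : ℕ} {i j : Fin (n + 1)} (hij : i ≠ j) :
    ∃ κ : Fin (n + 1) → Fin n, κ i = κ j ∧
      ∀ k l, κ k = κ l → k = l ∨ k = i ∧ l = j ∨ k = j ∧ l = i := by
  have h : ∀ k, ∃ z, j.succAbove z = if k = j then i else k := fun k =>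
    Fin.exists_succAbove_eq (by split_ifs with hk <;> assumption)
  choose κ hκ using h
  refine ⟨κ, ?_, fun k l hkl => ?_⟩
  · apply j.succAbove_right_injective
    rw [hκ, hκ]; simp
  · have := congrArg j.succAbove hkl
    rw [hκ, hκ] at this
    grind

/-- A labelling of the blocks by dual pairs of basis vectors which is compatible with exactly the
matchings `PM.ofEquiv g` and `PM.ofEquiv ((Equiv.swap x y).trans g)`. -/
lemma exists_label {n : ℕ} (g : Fin (n + 1) × Bool ≃ Fin (2 * (n + 1)))
    {x y : Fin (n + 1) × Bool} (hxy : x.1 ≠ y.1) :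
    ∃ L : Fin (2 * (n + 1)) → Fin n × Bool,
      (∀ i, L ((PM.ofEquiv ((Equiv.swap x y).trans g)).1 i) = ((L i).1, !(L i).2)) ∧
      ∀ M : PM (2 * (n + 1)), (∀ i, L (M.1 i) = ((L i).1, !(L i).2)) →
        M = PM.ofEquiv g ∨ M = PM.ofEquiv ((Equiv.swap x y).trans g) := by
  obtain ⟨κ, hκ, hκ'⟩ := exists_fin_collapse hxy
  obtain ⟨i, a⟩ := x
  obtain ⟨j, b⟩ := y
  simp only at hxy hκ hκ'
  let t : Fin (n + 1) → Bool := fun k => if k = i then a else if k = j then b else false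
  have hti : t i = a := by simp [t]
  have htj : t j = b := by simp [t, hxy.symm]
  let ℓ : Fin (n + 1) × Bool → Fin n × Bool := fun p => (κ p.1, xor p.2 (t p.1))
  have hflip : ∀ p, ℓ (p.1, !p.2) = ((ℓ p).1, !(ℓ p).2) := fun p => by simp [ℓ]
  let s := Equiv.swap (i, a) (j, b)
  have hs : ∀ p, ℓ (s p) = ℓ p := by
    intro p
    by_cases h1 : p = (i, a)
    · simp [s, h1, ℓ, hti, htj, hκ]
    by_cases h2 : p = (j, b)
    · simp [s, h2, ℓ, hti, htj, hκ]
    rw [Equiv.swap_apply_of_ne_of_ne h1 h2]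
  have hM' : ∀ p, (PM.ofEquiv (s.trans g)).1 (g p) = g (s ((s p).1, !(s p).2)) := by
    intro p
    have := PM.ofEquiv_apply (s.trans g) (s p)
    simpa [s] using this
  refine ⟨fun q => ℓ (g.symm q), fun q => ?_, fun M hM => ?_⟩
  · obtain ⟨p, rfl⟩ := g.surjective q
    change ℓ (g.symm ((PM.ofEquiv (s.trans g)).1 (g p))) = _
    rw [hM']
    simp only [Equiv.symm_apply_apply, hs, hflip]
  · obtain ⟨N, hN⟩ : ∃ N : Fin (n + 1) × Bool → Fin (n + 1) × Bool, ∀ p, M.1 (g p) = g (N p) :=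
      ⟨fun p => g.symm (M.1 (g p)), by simp⟩
    have hNN : ∀ p, N (N p) = p := fun p => g.injective (by rw [← hN, ← hN, M.2.1])
    have hℓN : ∀ p, ℓ (N p) = ℓ (p.1, !p.2) := by
      intro p
      have := hM (g p)
      rw [hN] at this
      simpa [hflip] using this
    have hfib : ∀ p q, ℓ p = ℓ q → p = q ∨ (p = (i, a) ∧ q = (j, b)) ∨ (p = (j, b) ∧ q = (i, a)) ∨
        (p = (i, !a) ∧ q = (j, !b)) ∨ (p = (j, !b) ∧ q = (i, !a)) := by
      rintro ⟨k, c⟩ ⟨l, d⟩ h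
      simp only [ℓ, Prod.mk.injEq] at h
      obtain ⟨h1, h2⟩ := h
      rcases hκ' _ _ h1 with rfl | ⟨rfl, rfl⟩ | ⟨rfl, rfl⟩
      · left; simpa using h2
      · rw [hti, htj] at h2
        revert h2
        cases a <;> cases b <;> cases c <;> cases d <;> simp
      · rw [hti, htj] at h2
        revert h2
        cases a <;> cases b <;> cases c <;> cases d <;> simp
    have hcase := fun p => hfib _ _ (hℓN p)
    have hx := hcase (i, a)
    have hx' := hcase (i, !a)
    have hy := hcase (j, b)
    have hy' := hcase (j, !b)
    have hNx' := hNN (i, a)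
    have hNx'' := hNN (i, !a)
    have hNy' := hNN (j, b)
    have hNy'' := hNN (j, !b)
    by_cases hNx : N (i, a) = (i, !a)
    · left
      refine PM.ext_of_equiv g fun p => ?_
      rw [hN, PM.ofEquiv_apply]
      congr 1
      have hp := hcase p
      obtain ⟨k, d⟩ := p
      grind
    · right
      refine PM.ext_of_equiv g fun p => ?_
      rw [hN]
      refine Eq.trans ?_ (hM' p).symm
      congr 1
      have hp := hcase p
      have e1 : N (i, a) = (j, !b) := by grind
      have e2 : N (j, !b) = (i, a) := by rw [← e1, hNN]
      have e3 : N (j, b) = (i, !a) := by grind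
      have e4 : N (i, !a) = (j, b) := by rw [← e3, hNN]
      have s1 : s (i, a) = (j, b) := Equiv.swap_apply_left _ _
      have s2 : s (j, b) = (i, a) := Equiv.swap_apply_right _ _
      have s0 : ∀ q, q ≠ (i, a) → q ≠ (j, b) → s q = q := fun q => Equiv.swap_apply_of_ne_of_ne
      have s3 : s (i, !a) = (i, !a) := s0 _ (by simp) (by simp [hxy])
      have s4 : s (j, !b) = (j, !b) := s0 _ (by simp [hxy.symm]) (by simp)
      by_cases p1 : p = (i, a)
      · simp [p1, e1, s1, s4]
      by_cases p2 : p = (j, b)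
      · simp [p2, e3, s2, s3]
      by_cases p3 : p = (i, !a)
      · simp [p3, e4, s1, s3]
      by_cases p4 : p = (j, !b)
      · simp [p4, e2, s2, s4]
      clear_value s
      rw [s0 p p1 p2]
      clear hx hx' hy hy' hcase hfib hflip hs hM' hℓN
      obtain ⟨k, d⟩ := p
      rw [s0] <;> grind

lemma ker_apply_swap {n : ℕ} {c : PM (2 * (n + 1)) →₀ ℂ} (hc : ThetaS n (n + 1) c = 0)
    (g : Fin (n + 1) × Bool ≃ Fin (2 * (n + 1))) (x y : Fin (n + 1) × Bool)
    (h0 : c (PM.ofEquiv g) = 0) : c (PM.ofEquiv ((Equiv.swap x y).trans g)) = 0 := by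
  by_cases hxy : x.1 = y.1
  · convert h0 using 2
    refine PM.ext_of_equiv ((Equiv.swap x y).trans g) fun p => ?_
    rw [PM.ofEquiv_apply, Equiv.trans_apply, Equiv.trans_apply, PM.ofEquiv_apply]
    congr 1
    obtain ⟨i, a⟩ := x
    obtain ⟨j, b⟩ := y
    obtain ⟨k, d⟩ := p
    simp only at hxy
    subst hxy
    by_cases hk : k = i
    · subst hk
      cases a <;> cases b <;> cases d <;> simp
    · rw [Equiv.swap_apply_of_ne_of_ne, Equiv.swap_apply_of_ne_of_ne] <;> simp [hk]
  · obtain ⟨L, hL, huniq⟩ := exists_label g hxy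
    have h := congrFun hc fun i => sympBasis n (L i)
    rw [ThetaS, Finsupp.linearCombination_apply, Finsupp.sum_fintype _ _ (by simp), Finset.sum_apply,
      Finset.sum_eq_single (PM.ofEquiv ((Equiv.swap x y).trans g))] at h
    · simp only [Pi.smul_apply, smul_eq_mul, Pi.zero_apply, mul_eq_zero] at h
      exact h.resolve_right ((phiS_sympBasis_ne_zero_iff _ L).2 hL)
    · intro M _ hM
      rw [Pi.smul_apply, smul_eq_mul, mul_eq_zero]
      by_contra! hne
      rcases huniq M ((phiS_sympBasis_ne_zero_iff M L).1 hne.2) with rfl | rfl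
      · exact hne.1 h0
      · exact hM rfl
    · simp

lemma eq_zero_of_ThetaS_eq_zero {n : ℕ} {c : PM (2 * (n + 1)) →₀ ℂ}
    (hc : ThetaS n (n + 1) c = 0) (e : Fin (n + 1) × Bool ≃ Fin (2 * (n + 1)))
    (h0 : c (PM.ofEquiv e) = 0) : c = 0 := by
  have h : ∀ σ : Equiv.Perm (Fin (n + 1) × Bool), c (PM.ofEquiv (σ.trans e)) = 0 := by
    intro σ
    induction σ using Equiv.Perm.swap_induction_on' with
    | one => exact h0
    | mul_swap f x y _ ih => exact ker_apply_swap hc (f.trans e) x y ih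
  ext M
  obtain ⟨σ, rfl⟩ := PM.exists_ofEquiv_eq e M
  exact h σ

/-- For `n ≥ 1` and `r = n+1`, the kernel of `Θ'_n` is one-dimensional. -/
theorem stmt16 (n : ℕ) (hn : 1 ≤ n) :
    Module.finrank ℂ ↥(LinearMap.ker (ThetaS n (n+1))) = 1 := by
  obtain ⟨e, he⟩ := PM.exists_ordered_equiv (n + 1)
  have hP := pfaffianElt_apply_ne_zero he
  have hker := ThetaS_pfaffianElt (Nat.lt_succ_self n) e
  refine (finrank_eq_one_iff_of_nonzero' (V := LinearMap.ker (ThetaS n (n + 1)))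
    ⟨pfaffianElt e, hker⟩ ?_).2 ?_
  · intro h
    exact hP (DFunLike.congr_fun (Subtype.ext_iff.1 h) (PM.ofEquiv e))
  · rintro ⟨w, hw⟩
    rw [LinearMap.mem_ker] at hw
    refine ⟨w (PM.ofEquiv e) / pfaffianElt e (PM.ofEquiv e), Subtype.ext ?_⟩
    refine sub_eq_zero.1 (eq_zero_of_ThetaS_eq_zero (e := e) ?_ ?_)
    · simp [hker, hw]
    · simp [hP]
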